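/- arXiv:1601.07736 — 3 statements merged into one kernel-verified Lean document; each statement's English description precedes it below -/
import Mathlib

section
/- Let S = [s_{ij}] be an n×n row-stochastic matrix. Then every (complex) eigenvalue λ of S lies in the set ⋂_{i=1}^{n} [G_{S(i)} ∪ {1}], where G_{S(i)} = ⋃_{k ≠ i} { z ∈ ℂ : |z − s_{kk} + s_{ik}| ≤ Σ_{j ≠ k} |s_{kj} − s_{ij}| }. Equivalently: for every eigenvalue λ of S and every index i ∈ {1, …, n}, either λ = 1 or there exists an index k ≠ i such that |λ − s_{kk} + s_{ik}| ≤ Σ_{j ≠ k} |s_{kj} − s_{ij}|. -/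
/-- Every complex eigenvalue `λ` of an `n×n` row-stochastic matrix `S`
lies in `⋂_{i} [G_{S(i)} ∪ {1}]`: for every index `i`, either `λ = 1` or there is
`k ≠ i` with `|λ - s_{kk} + s_{ik}| ≤ ∑_{j ≠ k} |s_{kj} - s_{ij}|`. -/
theorem stochastic_eigenvalue_localization (n : ℕ)
    (S : Matrix (Fin n) (Fin n) ℝ)
    (hnonneg : ∀ i j, 0 ≤ S i j)
    (hrow : ∀ i, ∑ j, S i j = 1)
    (lam : ℂ)
    (hev : ∃ v : Fin n → ℂ, v ≠ 0 ∧ (S.map (fun x => (x : ℂ))).mulVec v = lam • v) :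
    ∀ i : Fin n, lam = 1 ∨ ∃ k : Fin n, k ≠ i ∧
      ‖lam - (S k k : ℂ) + (S i k : ℂ)‖ ≤
        ∑ j ∈ Finset.univ.erase k, |S k j - S i j| := by
  obtain ⟨v, hv, hSv⟩ := hev
  intro i
  have hrowC : ∀ k, ∑ j, (S k j : ℂ) = 1 := fun k => by exact_mod_cast hrow k
  have heq : ∀ k, ∑ j, (S k j : ℂ) * v j = lam * v k := fun k => by
    simpa [Matrix.mulVec, dotProduct] using congrFun hSv k
  obtain ⟨k, -, hmax⟩ :=
    Finset.exists_max_image Finset.univ (fun j => ‖v j - v i‖) ⟨i, Finset.mem_univ i⟩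
  by_cases hk : v k - v i = 0
  · left
    have hconst : ∀ j, v j = v i := fun j => by
      have h := hmax j (Finset.mem_univ j)
      rw [hk, norm_zero] at h
      exact sub_eq_zero.mp (norm_le_zero_iff.mp h)
    have hvi : v i ≠ 0 := fun h => hv (funext fun j => (hconst j).trans h)
    have h := heq i
    simp_rw [hconst, ← Finset.sum_mul, hrowC] at h
    exact (mul_right_cancel₀ hvi h).symm
  · refine Or.inr ⟨k, fun h => hk (by rw [h, sub_self]), ?_⟩
    have hdiff : ∑ j, ((S k j : ℂ) - S i j) * (v j - v i) = lam * (v k - v i) := by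
      simp_rw [mul_sub, sub_mul, Finset.sum_sub_distrib, ← Finset.sum_mul, hrowC, heq]
      ring
    have hoff : (lam - (S k k : ℂ) + (S i k : ℂ)) * (v k - v i) =
        ∑ j ∈ Finset.univ.erase k, ((S k j : ℂ) - S i j) * (v j - v i) := by
      rw [← Finset.add_sum_erase _ _ (Finset.mem_univ k)] at hdiff
      linear_combination -hdiff
    refine le_of_mul_le_mul_right ?_ (norm_pos_iff.mpr hk)
    rw [← norm_mul, hoff, Finset.sum_mul]
    refine norm_sum_le_of_le _ fun j _ => ?_
    rw [norm_mul, ← Complex.ofReal_sub, Complex.norm_real, Real.norm_eq_abs]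
    exact mul_le_mul_of_nonneg_left (hmax j (Finset.mem_univ j)) (abs_nonneg _)
end

section
/- Let S = [s_{ij}] be an n×n row-stochastic matrix, and for each i let s_i = min_{j ≠ i} s_{ji} be the minimal element among the off-diagonal entries of the i-th column of S. Set γ = max_{1 ≤ i ≤ n} (s_{ii} − s_i). Then every eigenvalue λ of S with λ ≠ 1 satisfies |λ − γ| ≤ 1 − trace(S) + (n−1)γ. -/
open Matrix in
/-- Every right eigenvalue of a square matrix over a field is a left eigenvalue. -/
theorem Matrix.exists_vecMul_eq_smul_of_mulVec_eq_smul {ι K : Type*} [Fintype ι] [Field K]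
    {A : Matrix ι ι K} {μ : K} (h : ∃ v : ι → K, v ≠ 0 ∧ A *ᵥ v = μ • v) :
    ∃ x : ι → K, x ≠ 0 ∧ x ᵥ* A = μ • x := by
  classical
  obtain ⟨v, hv, hAv⟩ := h
  have hdet : (A - μ • (1 : Matrix ι ι K)).det = 0 :=
    Matrix.exists_mulVec_eq_zero_iff.mp
      ⟨v, hv, by rw [sub_mulVec, smul_mulVec, one_mulVec, hAv, sub_self]⟩
  obtain ⟨x, hx, hxA⟩ := Matrix.exists_vecMul_eq_zero_iff.mpr hdet
  refine ⟨x, hx, ?_⟩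
  rwa [vecMul_sub, vecMul_smul, vecMul_one, sub_eq_zero] at hxA

open Matrix in
/-- A left eigenvector of a matrix with unit row sums, for an eigenvalue other than `1`,
has entries summing to zero. -/
theorem Matrix.sum_eq_zero_of_vecMul_eq_smul {ι K : Type*} [Fintype ι] [Field K]
    {A : Matrix ι ι K} (hA : ∀ i, ∑ j, A i j = 1) {μ : K} (hμ : μ ≠ 1) {x : ι → K}
    (hx : x ᵥ* A = μ • x) : ∑ i, x i = 0 := by
  have h : ∑ i, x i = μ * ∑ i, x i := by
    calc ∑ i, x i = ∑ i, x i * ∑ j, A i j := by simp [hA]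
      _ = ∑ j, (x ᵥ* A) j := by
        simp only [Finset.mul_sum, vecMul, dotProduct]
        exact Finset.sum_comm
      _ = μ * ∑ i, x i := by simp [hx, Finset.mul_sum]
  have h' : (μ - 1) * ∑ i, x i = 0 := by linear_combination -h
  exact (mul_eq_zero.mp h').resolve_left (sub_ne_zero.mpr hμ)

/-- An eigenvalue of a nonnegative matrix with constant row sum `r` has modulus at most `r`. -/
theorem Matrix.norm_le_of_vecMul_eq_smul {ι : Type*} [Fintype ι]
    {M : Matrix ι ι ℝ} (hM : ∀ i j, 0 ≤ M i j) {r : ℝ} (hr : ∀ i, ∑ j, M i j = r)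
    {μ : ℂ} {x : ι → ℂ} (hx : x ≠ 0) (hxM : ∀ j, ∑ i, x i * (M i j : ℂ) = μ * x j) :
    ‖μ‖ ≤ r := by
  obtain ⟨k, hk⟩ := Function.ne_iff.mp hx
  have hpos : 0 < ∑ i, ‖x i‖ :=
    Finset.sum_pos' (fun i _ => norm_nonneg _) ⟨k, Finset.mem_univ k, norm_pos_iff.mpr hk⟩
  refine le_of_mul_le_mul_right ?_ hpos
  calc ‖μ‖ * ∑ i, ‖x i‖ = ∑ j, ‖∑ i, x i * (M i j : ℂ)‖ := by
        simp [hxM, Finset.mul_sum]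
    _ ≤ ∑ j, ∑ i, ‖x i‖ * M i j := by
        refine Finset.sum_le_sum fun j _ => (norm_sum_le _ _).trans_eq ?_
        exact Finset.sum_congr rfl fun i _ => by
          rw [norm_mul, Complex.norm_of_nonneg (hM i j)]
    _ = r * ∑ i, ‖x i‖ := by
        rw [Finset.sum_comm]
        simp only [← Finset.mul_sum, hr]
        rw [← Finset.sum_mul, mul_comm]

/-- Cvetković et al.: Let `S` be an `n×n` row-stochastic matrix, let
`s i = min_{j ≠ i} S j i` be the minimal off-diagonal entry of the `i`-th column,
and `γ = max_i (S i i - s i)`. Then every complex eigenvalue `λ ≠ 1` of `S`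
satisfies `|λ - γ| ≤ 1 - trace S + (n - 1) γ`. -/
theorem cvetkovic_eigenvalue_disc (n : ℕ)
    (S : Matrix (Fin n) (Fin n) ℝ)
    (hnonneg : ∀ i j, 0 ≤ S i j)
    (hrow : ∀ i, ∑ j, S i j = 1)
    (s : Fin n → ℝ) (hs : ∀ i, s i = ⨅ j : {j : Fin n // j ≠ i}, S j i)
    (γ : ℝ) (hγ : γ = ⨆ i : Fin n, (S i i - s i))
    (lam : ℂ) (hlam : lam ≠ 1)
    (hev : ∃ v : Fin n → ℂ, v ≠ 0 ∧ (S.map (fun x => (x : ℂ))).mulVec v = lam • v) :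
    ‖lam - (γ : ℂ)‖ ≤ 1 - Matrix.trace S + ((n : ℝ) - 1) * γ := by
  obtain ⟨x, hx, hxS⟩ := Matrix.exists_vecMul_eq_smul_of_mulVec_eq_smul hev
  have hsum : ∑ i, x i = 0 :=
    Matrix.sum_eq_zero_of_vecMul_eq_smul
      (fun i => by simpa using congrArg (fun t : ℝ => (t : ℂ)) (hrow i)) hlam hxS
  have hle : ∀ i j, j ≠ i → S i i - γ ≤ S j i := by
    intro i j hji
    have h1 : s i ≤ S j i := by
      rw [hs i]
      exact ciInf_le (f := fun j : {j : Fin n // j ≠ i} => S j i)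
        (Set.finite_range _).bddBelow ⟨j, hji⟩
    have h2 : S i i - s i ≤ γ := by
      rw [hγ]
      exact le_ciSup (f := fun i => S i i - s i) (Set.finite_range _).bddAbove i
    linarith
  -- Subtracting a rank-one matrix with constant columns does not affect the left eigenvector.
  let M : Matrix (Fin n) (Fin n) ℝ :=
    fun j i => S j i - (S i i - γ) - if j = i then γ else 0
  refine Matrix.norm_le_of_vecMul_eq_smul (M := M) ?_ ?_ hx ?_
  · intro j i
    by_cases hji : j = i
    · simp [M, hji]
    · simpa [M, hji] using hle i j hji
  · intro j
    simp only [M, Finset.sum_sub_distrib, hrow, Matrix.trace, Matrix.diag,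
      Finset.sum_ite_eq, Finset.mem_univ, if_true, Finset.sum_const, Finset.card_univ,
      Fintype.card_fin, nsmul_eq_mul]
    ring
  · intro i
    have hi : ∑ j, x j * (S j i : ℂ) = lam * x i := by
      simpa [Matrix.vecMul, dotProduct] using congrFun hxS i
    calc ∑ j, x j * (M j i : ℂ)
        = ∑ j, (x j * (S j i : ℂ) - x j * ((S i i : ℂ) - γ) - if j = i then x j * γ else 0) := by
          refine Finset.sum_congr rfl fun j _ => ?_
          by_cases hji : j = i <;> simp [M, hji] <;> ring
      _ = (lam - γ) * x i := by
          rw [Finset.sum_sub_distrib, Finset.sum_sub_distrib, hi, ← Finset.sum_mul, hsum]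
          simp
          ring
end

section
/- Let Γ be a simple connected graph on n vertices with Randić transition matrix 𝓡 = [r_{ij}] where r_{ij} = 1/d_i if i ∼ j and 0 otherwise. If i and k are distinct adjacent vertices (k ∼ i), then Σ_{j ≠ i, j ≠ k} |r_{kj} − r_{ij}| = 2 − 1/d_k − 1/d_i − 2N(i,k)/max{d_i, d_k}. -/
/-- The absolute difference of two reciprocals, in terms of the larger denominator. -/
lemma abs_one_div_sub_one_div {a b : ℝ} (ha : 0 < a) (hb : 0 < b) :
    |1 / a - 1 / b| = 1 / a + 1 / b - 2 * (1 / max b a) := by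
  rcases le_total a b with h | h
  · rw [max_eq_left h, abs_of_nonneg (sub_nonneg.2 (one_div_le_one_div_of_le ha h))]
    ring
  · rw [max_eq_right h, abs_of_nonpos (sub_nonpos.2 (one_div_le_one_div_of_le hb h))]
    ring

/-- Each row of the transition matrix of a graph sums to one at a non-isolated vertex. -/
lemma SimpleGraph.sum_ite_adj_one_div_degree {V : Type*} [Fintype V] (G : SimpleGraph V)
    [DecidableRel G.Adj] (v : V) (hv : 0 < G.degree v) :
    ∑ w, (if G.Adj v w then 1 / (G.degree v : ℝ) else 0) = 1 := by
  have hv' : (G.degree v : ℝ) ≠ 0 := by positivity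
  rw [← Finset.sum_filter, Finset.sum_const, ← G.neighborFinset_eq_filter,
    G.card_neighborFinset_eq_degree, nsmul_eq_mul, mul_one_div_cancel hv']

/-- For a simple connected graph on `n` vertices with Randić transition
matrix entries `r_{ij} = 1/d_i` if `i ∼ j` and `0` otherwise, and for distinct
adjacent vertices `i ∼ k`:
`∑_{j ≠ i,k} |r_{kj} - r_{ij}| = 2 - 1/d_k - 1/d_i - 2N(i,k)/max{d_i, d_k}`. -/
theorem randic_row_difference_sum_adjacent (n : ℕ)
    (G : SimpleGraph (Fin n)) [DecidableRel G.Adj]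
    (hconn : G.Connected)
    (R : Matrix (Fin n) (Fin n) ℝ)
    (hR : ∀ i j, R i j = if G.Adj i j then 1 / (G.degree i : ℝ) else 0)
    (i k : Fin n) (hik : i ≠ k) (hadj : G.Adj i k) :
    ∑ j ∈ (Finset.univ.erase i).erase k, |R k j - R i j| =
      2 - 1 / (G.degree k : ℝ) - 1 / (G.degree i : ℝ) -
        2 * ((G.neighborFinset i ∩ G.neighborFinset k).card : ℝ) /
          max (G.degree i : ℝ) (G.degree k : ℝ) := by
  have hdi : 0 < G.degree i := G.degree_pos_iff_exists_adj i |>.2 ⟨k, hadj⟩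
  have hdk : 0 < G.degree k := G.degree_pos_iff_exists_adj k |>.2 ⟨i, hadj.symm⟩
  have hpoint : ∀ j, |R k j - R i j| = R k j + R i j -
      2 * (if j ∈ G.neighborFinset i ∩ G.neighborFinset k then
        1 / max (G.degree i : ℝ) (G.degree k : ℝ) else 0) := by
    intro j
    rw [hR, hR]
    by_cases hk : G.Adj k j <;> by_cases hi : G.Adj i j <;> simp only [Finset.mem_inter,
      SimpleGraph.mem_neighborFinset, hk, hi, and_true, and_false, if_true, if_false]
    · exact abs_one_div_sub_one_div (by positivity) (by positivity)
    all_goals simp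
  have htotal : ∑ j, |R k j - R i j| = 2 -
      2 * ((G.neighborFinset i ∩ G.neighborFinset k).card : ℝ) /
        max (G.degree i : ℝ) (G.degree k : ℝ) := by
    simp only [hpoint, Finset.sum_sub_distrib, Finset.sum_add_distrib, ← Finset.mul_sum,
      Finset.sum_ite_mem, Finset.univ_inter, Finset.sum_const, nsmul_eq_mul]
    simp only [hR, G.sum_ite_adj_one_div_degree _ hdi, G.sum_ite_adj_one_div_degree _ hdk]
    ring
  have hi : |R k i - R i i| = 1 / (G.degree k : ℝ) := by
    simp [hR, hadj.symm]
  have hk : |R k k - R i k| = 1 / (G.degree i : ℝ) := by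
    simp [hR, hadj]
  rw [Finset.sum_erase_eq_sub (by simp [hik.symm]), Finset.sum_erase_eq_sub (Finset.mem_univ i),
    htotal, hi, hk]
  ring
end
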